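/- arXiv:2505.14232 — 2 statements merged into one kernel-verified Lean document; each statement's English description precedes it below -/
import Mathlib

section
/- Let d = min(m, 3) where m ≥ 0 is a natural number, let δ ≠ 0 be real, let x ∈ ℝ², and suppose interpolation weights w_{ij} (indexed by the five offsets Δ₁ = (0,0), Δ₂ = (δ,0), Δ₃ = (-δ,0), Δ₄ = (0,δ), Δ₅ = (0,-δ) and nodes x₁, …, xₙ ∈ ℝ²) reproduce all bivariate polynomials of total degree at most m, i.e. p(x + Δᵢ) = Σⱼ w_{ij} p(xⱼ) for all such p and all i. Then the hybrid five-point approximation with weights a = (-4, 1, 1, 1, 1)/δ² satisfies Σᵢ aᵢ Σⱼ w_{ij} p(xⱼ) = Δp(x) for every bivariate polynomial p of total degree at most d; that is, the polynomial reproduction degree of the hybrid method with the five-point stencil is at least min(m, 3). -/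
open MvPolynomial Finset

/-- The five-point second difference of a bivariate monomial of total degree at most three
equals `δ ^ 2` times its Laplacian. -/
theorem fivepoint_stencil_monomial (s : Fin 2 →₀ ℕ) (hs : s 0 + s 1 ≤ 3) (c δ : ℝ)
    (x : Fin 2 → ℝ) :
    -4 * eval x (monomial s c) + eval (x + ![δ, 0]) (monomial s c)
        + eval (x + ![-δ, 0]) (monomial s c) + eval (x + ![0, δ]) (monomial s c)
        + eval (x + ![0, -δ]) (monomial s c)
      = δ ^ 2 * eval x (pderiv 0 (pderiv 0 (monomial s c)) + pderiv 1 (pderiv 1 (monomial s c))) := by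
  have h0 : s 0 ≤ 3 := by omega
  have h1 : s 1 ≤ 3 := by omega
  simp only [pderiv_monomial, map_add, eval_monomial,
    Finsupp.prod_fintype _ _ (fun _ => pow_zero _), Fin.prod_univ_two, Finsupp.tsub_apply,
    Finsupp.single_apply, Pi.add_apply, Matrix.cons_val_zero, Matrix.cons_val_one]
  generalize s 0 = k at *
  generalize s 1 = l at *
  interval_cases k <;> interval_cases l <;> first | omega | (norm_num; ring)

/-- The five-point second difference of a bivariate polynomial of total degree at most three
equals `δ ^ 2` times its Laplacian. -/
theorem fivepoint_stencil_of_totalDegree_le_three (p : MvPolynomial (Fin 2) ℝ)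
    (hp : p.totalDegree ≤ 3) (δ : ℝ) (x : Fin 2 → ℝ) :
    -4 * eval x p + eval (x + ![δ, 0]) p + eval (x + ![-δ, 0]) p + eval (x + ![0, δ]) p
        + eval (x + ![0, -δ]) p
      = δ ^ 2 * eval x (pderiv 0 (pderiv 0 p) + pderiv 1 (pderiv 1 p)) := by
  have key := Finset.sum_congr (rfl : p.support = p.support) fun s hs =>
    fivepoint_stencil_monomial s (by
      have h := (le_totalDegree hs).trans hp
      rwa [Finsupp.sum_fintype _ _ (fun _ => rfl), Fin.sum_univ_two] at h) (coeff s p) δ x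
  simpa only [map_add, Finset.sum_add_distrib, ← Finset.mul_sum, ← map_sum,
    support_sum_monomial_coeff] using key

/-- If the interpolation weights reproduce bivariate polynomials of total degree
at most `m`, then the hybrid method with the five-point stencil (offsets
`(0,0), (±δ,0), (0,±δ)` and weights `(-4,1,1,1,1)/δ²`) is exact for the
Laplacian on bivariate polynomials of total degree at most `min m 3`. -/
theorem hybrid_fivepoint_reproduction_degree
    (m : ℕ) (δ : ℝ) (hδ : δ ≠ 0) (x : Fin 2 → ℝ)
    (n : ℕ) (xs : Fin n → (Fin 2 → ℝ)) (w : Fin 5 → Fin n → ℝ)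
    (Δ : Fin 5 → (Fin 2 → ℝ))
    (hΔ : Δ = ![![0, 0], ![δ, 0], ![-δ, 0], ![0, δ], ![0, -δ]])
    (a : Fin 5 → ℝ) (ha : a = fun i => ![-4, 1, 1, 1, 1] i / δ ^ 2)
    (hinterp : ∀ p : MvPolynomial (Fin 2) ℝ, p.totalDegree ≤ m → ∀ i : Fin 5,
      eval (x + Δ i) p = ∑ j, w i j * eval (xs j) p) :
    ∀ p : MvPolynomial (Fin 2) ℝ, p.totalDegree ≤ min m 3 →
      ∑ i : Fin 5, a i * ∑ j, w i j * eval (xs j) p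
        = eval x (pderiv 0 (pderiv 0 p) + pderiv 1 (pderiv 1 p)) := by
  intro p hp
  have hm : p.totalDegree ≤ m := hp.trans (min_le_left _ _)
  have key := fivepoint_stencil_of_totalDegree_le_three p (hp.trans (min_le_right _ _)) δ x
  have hzero : x + ![0, 0] = x := by
    ext i
    fin_cases i <;> simp
  simp_rw [← hinterp p hm]
  rw [← mul_right_inj' (pow_ne_zero 2 hδ), ← key]
  subst hΔ ha
  simp only [Fin.sum_univ_five, Matrix.cons_val, hzero]
  field_simp
end

section
/- Let d = min(m, 5) where m ≥ 0 is a natural number, let δ ≠ 0 be real, let x ∈ ℝ², and suppose interpolation weights w_{ij} (indexed by the nine offsets (0,0), (±δ,0), (0,±δ), (±2δ,0), (0,±2δ) and nodes x₁, …, xₙ ∈ ℝ²) reproduce all bivariate polynomials of total degree at most m, i.e. p(x + Δᵢ) = Σⱼ w_{ij} p(xⱼ) for all such p and all i. Then the hybrid nine-point approximation with weights (divided by δ²) equal to -5 at the center, 4/3 at the four offsets of length δ, and -1/12 at the four offsets of length 2δ, satisfies Σᵢ aᵢ Σⱼ w_{ij} p(xⱼ) = Δp(x) for every bivariate polynomial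 p of total degree at most d; that is, the polynomial reproduction degree of the hybrid method with the nine-point stencil is at least min(m, 5). -/
open MvPolynomial Finset

/-- The fourth-order five-point approximation of the second derivative is exact on `t ^ k` for
`k ≤ 5`. -/
theorem fivePoint_stencil_pow {k : ℕ} (hk : k ≤ 5) (t δ : ℝ) :
    -5 / 2 * t ^ k + 4 / 3 * ((t + δ) ^ k + (t - δ) ^ k)
        - 1 / 12 * ((t + 2 * δ) ^ k + (t - 2 * δ) ^ k)
      = δ ^ 2 * (k * (k - 1 : ℕ) * t ^ (k - 1 - 1)) := by
  interval_cases k <;> norm_num <;> ring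

theorem MvPolynomial.eval_monomial_fin_two (s : Fin 2 →₀ ℕ) (c : ℝ) (y : Fin 2 → ℝ) :
    eval y (monomial s c) = c * (y 0 ^ s 0 * y 1 ^ s 1) := by
  simp [eval_monomial, Finsupp.prod_fintype]

/-- The nine-point stencil computes the Laplacian of bivariate polynomials of total degree at
most `5` exactly. -/
theorem ninePoint_stencil_eval {p : MvPolynomial (Fin 2) ℝ} (hp : p.totalDegree ≤ 5)
    (x : Fin 2 → ℝ) (δ : ℝ) :
    -5 * eval x p
        + 4 / 3 * (eval (x + ![δ, 0]) p + eval (x + ![-δ, 0]) p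
          + eval (x + ![0, δ]) p + eval (x + ![0, -δ]) p)
        - 1 / 12 * (eval (x + ![2 * δ, 0]) p + eval (x + ![-(2 * δ), 0]) p
          + eval (x + ![0, 2 * δ]) p + eval (x + ![0, -(2 * δ)]) p)
      = δ ^ 2 * eval x (pderiv 0 (pderiv 0 p) + pderiv 1 (pderiv 1 p)) := by
  rw [p.as_sum]
  refine Finset.sum_induction _ (fun q : MvPolynomial (Fin 2) ℝ =>
    -5 * eval x q
        + 4 / 3 * (eval (x + ![δ, 0]) q + eval (x + ![-δ, 0]) q
          + eval (x + ![0, δ]) q + eval (x + ![0, -δ]) q)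
        - 1 / 12 * (eval (x + ![2 * δ, 0]) q + eval (x + ![-(2 * δ), 0]) q
          + eval (x + ![0, 2 * δ]) q + eval (x + ![0, -(2 * δ)]) q)
      = δ ^ 2 * eval x (pderiv 0 (pderiv 0 q) + pderiv 1 (pderiv 1 q))) ?_ (by simp) ?_
  · intro q r hq hr
    simp only [map_add] at hq hr ⊢
    linear_combination hq + hr
  · intro s hs
    have hdeg : s 0 + s 1 ≤ 5 := by
      simpa [Finsupp.sum_fintype] using (le_totalDegree hs).trans hp
    have h0 := fivePoint_stencil_pow (k := s 0) (by omega) (x 0) δ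
    have h1 := fivePoint_stencil_pow (k := s 1) (by omega) (x 1) δ
    simp [-Matrix.add_cons, pderiv_monomial, MvPolynomial.eval_monomial_fin_two, ← sub_eq_add_neg] at h0 h1 ⊢
    linear_combination coeff s p * x 1 ^ s 1 * h0 + coeff s p * x 0 ^ s 0 * h1

/-- If the interpolation weights reproduce bivariate polynomials of total degree
at most `m`, then the hybrid method with the nine-point stencil (offsets
`(0,0), (±δ,0), (0,±δ), (±2δ,0), (0,±2δ)` with weights, divided by `δ²`, equal
to `-5` at the center, `4/3` at the offsets of length `δ` and `-1/12` at the
offsets of length `2δ`) is exact for the Laplacian on bivariate polynomials of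
total degree at most `min m 5`. -/
theorem hybrid_ninepoint_reproduction_degree
    (m : ℕ) (δ : ℝ) (hδ : δ ≠ 0) (x : Fin 2 → ℝ)
    (n : ℕ) (xs : Fin n → (Fin 2 → ℝ)) (w : Fin 9 → Fin n → ℝ)
    (Δ : Fin 9 → (Fin 2 → ℝ))
    (hΔ : Δ = ![![0, 0], ![δ, 0], ![-δ, 0], ![0, δ], ![0, -δ],
      ![2 * δ, 0], ![-(2 * δ), 0], ![0, 2 * δ], ![0, -(2 * δ)]])
    (a : Fin 9 → ℝ)
    (ha : a = fun i =>
      ![-5, 4 / 3, 4 / 3, 4 / 3, 4 / 3, -1 / 12, -1 / 12, -1 / 12, -1 / 12] i / δ ^ 2)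
    (hinterp : ∀ p : MvPolynomial (Fin 2) ℝ, p.totalDegree ≤ m → ∀ i : Fin 9,
      eval (x + Δ i) p = ∑ j, w i j * eval (xs j) p) :
    ∀ p : MvPolynomial (Fin 2) ℝ, p.totalDegree ≤ min m 5 →
      ∑ i : Fin 9, a i * ∑ j, w i j * eval (xs j) p
        = eval x (pderiv 0 (pderiv 0 p) + pderiv 1 (pderiv 1 p)) := by
  intro p hp
  have hstencil := ninePoint_stencil_eval (hp.trans (min_le_right m 5)) x δ
  have hzero : x + ![0, 0] = x := by ext i; fin_cases i <;> simp
  simp only [← hinterp p (hp.trans (min_le_left m 5))]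
  subst hΔ ha
  refine mul_left_cancel₀ (pow_ne_zero 2 hδ) (Eq.trans ?_ hstencil)
  simp [-Matrix.add_cons, Fin.sum_univ_succ, hzero]
  field_simp
  ring
end
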